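/- The class of countable graphs with no ray minor has no minor-universal element: there is no countable graph U such that U has no ray minor and every countable graph with no ray minor is a minor of U. -/

import Mathlib

/-- `H` is a minor of `G`: pairwise disjoint nonempty connected branch sets, one for each
vertex of `H`, with a `G`-edge between the branch sets of any two `H`-adjacent vertices. -/
def IsMinor {V : Type*} {W : Type*} (H : SimpleGraph V) (G : SimpleGraph W) : Prop :=
  ∃ B : V → Set W,
    (∀ v : V, (G.induce (B v)).Connected) ∧
    (∀ u v : V, u ≠ v → Disjoint (B u) (B v)) ∧
    (∀ u v : V, H.Adj u v → ∃ x ∈ B u, ∃ y ∈ B v, G.Adj x y)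

/-- The ray: the one-way infinite path on vertex set `ℕ`, with edges `{n, n+1}`. -/
def rayGraph : SimpleGraph ℕ := SimpleGraph.fromRel (fun m n => n = m + 1)

namespace SimpleGraph

variable {V : Type*}

/-- The graph obtained from `G` by adding one vertex adjacent to all the others. -/
def apexExtension (G : SimpleGraph V) : SimpleGraph (Option V) where
  Adj a b := match a, b with
    | some u, some v => G.Adj u v
    | none, none => False
    | _, _ => True
  symm := ⟨by
    rintro (_ | u) (_ | v) h
    · exact h
    · trivial
    · trivial
    · exact SimpleGraph.Adj.symm (G := G) h⟩
  loopless := ⟨by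
    rintro (_ | u) h
    · exact h
    · exact G.loopless.irrefl u h⟩

theorem connected_induce_preimage_some {G : SimpleGraph V} {s : Set (Option V)}
    (hs : (G.apexExtension.induce s).Connected) (hnone : none ∉ s) :
    (G.induce (some ⁻¹' s)).Connected := by
  let e : (some ⁻¹' s : Set V) ≃ s := Equiv.ofBijective (fun x => ⟨some x.1, x.2⟩) (by
    constructor
    · rintro ⟨x, hx⟩ ⟨y, hy⟩ h
      simpa using h
    · rintro ⟨_ | x, hx⟩
      · exact absurd hx hnone
      · exact ⟨⟨x, hx⟩, rfl⟩)
  let φ : G.induce (some ⁻¹' s) ≃g G.apexExtension.induce s := ⟨e, Iff.rfl⟩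
  exact φ.connected_iff.mpr hs

/-- Adding a vertex to a graph without a ray minor does not create a ray minor. -/
theorem isMinor_rayGraph_of_apexExtension {G : SimpleGraph V}
    (h : IsMinor rayGraph G.apexExtension) : IsMinor rayGraph G := by
  obtain ⟨B, hconn, hdisj, hadj⟩ := h
  obtain ⟨N, hN⟩ : ∃ N, ∀ n, none ∉ B (n + N) := by
    by_cases hk : ∃ k, none ∈ B k
    · obtain ⟨k, hk⟩ := hk
      refine ⟨k + 1, fun n hn => ?_⟩
      exact Set.disjoint_left.mp (hdisj k (n + (k + 1)) (by omega)) hk hn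
    · exact ⟨0, fun n hn => hk ⟨_, hn⟩⟩
  refine ⟨fun n => some ⁻¹' B (n + N),
    fun n => connected_induce_preimage_some (hconn _) (hN n),
    fun m n hmn => (hdisj _ _ (by omega)).preimage _, fun m n hmn => ?_⟩
  have hmn' : rayGraph.Adj (m + N) (n + N) := by
    simp only [rayGraph, fromRel_adj] at hmn ⊢
    omega
  obtain ⟨x, hx, y, hy, hxy⟩ := hadj _ _ hmn'
  rcases x with _ | x
  · exact absurd hx (hN m)
  rcases y with _ | y
  · exact absurd hy (hN n)
  exact ⟨x, hx, y, hy, hxy⟩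

/-- The union of the branch sets of a connected vertex set is connected. -/
theorem connected_induce_biUnion {W : Type*} {H : SimpleGraph V} {G : SimpleGraph W}
    {B : V → Set W} (hconn : ∀ v, (G.induce (B v)).Connected)
    (hadj : ∀ u v, H.Adj u v → ∃ x ∈ B u, ∃ y ∈ B v, G.Adj x y)
    {s : Set V} (hs : (H.induce s).Connected) :
    (G.induce (⋃ v ∈ s, B v)).Connected := by
  have hsub : ∀ v ∈ s, B v ⊆ ⋃ v ∈ s, B v := fun v hv => Set.subset_biUnion_of_mem hv
  have hbranch : ∀ (v : V) (hv : v ∈ s) (x y : W) (hx : x ∈ B v) (hy : y ∈ B v),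
      (G.induce (⋃ v ∈ s, B v)).Reachable ⟨x, hsub v hv hx⟩ ⟨y, hsub v hv hy⟩ :=
    fun v hv x y hx hy =>
      ((hconn v).preconnected ⟨x, hx⟩ ⟨y, hy⟩).map (G.induceHomOfLE (hsub v hv)).toHom
  have hwalk : ∀ (u v : s) (_ : (H.induce s).Walk u v) (x y : W) (hx : x ∈ B u) (hy : y ∈ B v),
      (G.induce (⋃ v ∈ s, B v)).Reachable ⟨x, hsub u u.2 hx⟩ ⟨y, hsub v v.2 hy⟩ := by
    intro u v p
    induction p with
    | nil => exact fun x y hx hy => hbranch _ (Subtype.prop _) x y hx hy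
    | @cons u w v huw _ ih =>
      intro x y hx hy
      obtain ⟨a, ha, b, hb, hab⟩ := hadj u w huw
      have hstep : (G.induce (⋃ v ∈ s, B v)).Adj ⟨a, hsub u u.2 ha⟩ ⟨b, hsub w w.2 hb⟩ := hab
      exact (hbranch u u.2 x a hx ha).trans (hstep.reachable.trans (ih b y hb hy))
  obtain ⟨v⟩ := hs.nonempty
  obtain ⟨x⟩ := (hconn v).nonempty
  have : Nonempty (⋃ v ∈ s, B v : Set W) := ⟨⟨x, hsub v v.2 x.2⟩⟩
  refine ⟨?_⟩
  rintro ⟨x, hx⟩ ⟨y, hy⟩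
  obtain ⟨u, hu, hxu⟩ := Set.mem_iUnion₂.mp hx
  obtain ⟨v, hv, hyv⟩ := Set.mem_iUnion₂.mp hy
  obtain ⟨p⟩ := hs.preconnected ⟨u, hu⟩ ⟨v, hv⟩
  exact hwalk _ _ p x y hxu hyv

/-- A graph that contains its own apex extension as a minor has a ray minor: iterating the
minor embedding on the branch set of the apex yields the branch sets of a ray. -/
theorem isMinor_rayGraph_of_isMinor_apexExtension {G : SimpleGraph V}
    (h : IsMinor G.apexExtension G) : IsMinor rayGraph G := by
  obtain ⟨B, hconn, hdisj, hadj⟩ := h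
  let f : Set V → Set V := fun s => ⋃ v ∈ s, B (some v)
  let A : ℕ → Set V := fun n => f^[n] (B none)
  have hsucc : ∀ n, A (n + 1) = f (A n) := fun n => Function.iterate_succ_apply' f n _
  have hA : ∀ n, (G.induce (A n)).Connected := by
    intro n
    induction n with
    | zero => exact hconn none
    | succ n ih =>
      rw [hsucc]
      exact connected_induce_biUnion (fun v => hconn (some v))
        (fun u v huv => hadj (some u) (some v) huv) ih
  have hzero : ∀ s, Disjoint (B none) (f s) := fun s =>
    Set.disjoint_iUnion₂_right.mpr fun v _ => hdisj none (some v) (by simp)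
  have hf : ∀ s t, Disjoint s t → Disjoint (f s) (f t) := fun s t hst =>
    Set.disjoint_iUnion₂_left.mpr fun u hu => Set.disjoint_iUnion₂_right.mpr fun v hv =>
      hdisj _ _ fun huv => Set.disjoint_left.mp hst hu (Option.some.inj huv ▸ hv)
  have hlt : ∀ m k, Disjoint (A m) (A (m + k + 1)) := by
    intro m k
    induction m with
    | zero => rw [hsucc]; exact hzero _
    | succ m ih =>
      rw [hsucc, hsucc, show m + 1 + k = m + k + 1 by omega]
      exact hf _ _ ih
  have hstep : ∀ n, ∃ x ∈ A n, ∃ y ∈ A (n + 1), G.Adj x y := by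
    intro n
    induction n with
    | zero =>
      obtain ⟨v, hv⟩ := (hconn none).nonempty
      obtain ⟨x, hx, y, hy, hxy⟩ := hadj none (some v) trivial
      exact ⟨x, hx, y, Set.mem_biUnion (t := fun v => B (some v)) hv hy, hxy⟩
    | succ n ih =>
      obtain ⟨u, hu, v, hv, huv⟩ := ih
      obtain ⟨x, hx, y, hy, hxy⟩ := hadj (some u) (some v) huv
      rw [hsucc (n + 1), hsucc n]
      rw [hsucc n] at hv
      exact ⟨x, Set.mem_biUnion (t := fun v => B (some v)) hu hx, y,
        Set.mem_biUnion (t := fun v => B (some v)) hv hy, hxy⟩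
  refine ⟨A, hA, fun m n hmn => ?_, fun m n hmn => ?_⟩
  · rcases lt_or_gt_of_ne hmn with hmn | hmn
    · obtain ⟨k, rfl⟩ := Nat.exists_eq_add_of_lt hmn
      exact hlt m k
    · obtain ⟨k, rfl⟩ := Nat.exists_eq_add_of_lt hmn
      exact (hlt n k).symm
  · simp only [rayGraph, fromRel_adj] at hmn
    obtain ⟨-, rfl | rfl⟩ := hmn
    · exact hstep m
    · obtain ⟨x, hx, y, hy, hxy⟩ := hstep n
      exact ⟨y, hy, x, hx, hxy.symm⟩

end SimpleGraph

/-- The class of countable graphs with no ray minor has no minor-universal element. -/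
theorem no_universal_rayless :
    ¬ ∃ (V : Type) (_ : Countable V) (U : SimpleGraph V),
        ¬ IsMinor rayGraph U ∧
        ∀ (W : Type) (_ : Countable W) (G : SimpleGraph W),
          ¬ IsMinor rayGraph G → IsMinor G U := by
  rintro ⟨V, _, U, hU, huniv⟩
  exact hU (SimpleGraph.isMinor_rayGraph_of_isMinor_apexExtension
    (huniv (Option V) inferInstance U.apexExtension
      fun h => hU (SimpleGraph.isMinor_rayGraph_of_apexExtension h)))
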